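/- arXiv:1501.01949 — 2 statements merged into one kernel-verified Lean document; each statement's English description precedes it below -/
import Mathlib

section
/- Let X be a topological space containing a dense σ-compact subset. If X is (ω₁,ω)-paracompact, then X is Lindelöf. If X is a regular Hausdorff space that is (ω₁,ω)-metrizable, then X is separable metrizable. -/
open Set TopologicalSpace Topology

/-- A family of sets is locally finite at a point `x`: `x` has a neighborhood meeting
only finitely many members of the family. -/
def LocallyFiniteAt {X : Type*} [TopologicalSpace X] (x : X) (C : Set (Set X)) : Prop :=
  ∃ U ∈ nhds x, {A ∈ C | (A ∩ U).Nonempty}.Finite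

/-- A family of sets is locally finite in `X`. -/
def LocallyFiniteFamily {X : Type*} [TopologicalSpace X] (C : Set (Set X)) : Prop :=
  ∀ x : X, LocallyFiniteAt x C

/-- A poset is directed: every pair of elements has an upper bound. -/
def DirectedPoset (P : Type*) [Preorder P] : Prop :=
  ∀ a b : P, ∃ c : P, a ≤ c ∧ b ≤ c

/-- A poset has calibre (ω₁,ω) if every uncountable subset contains an infinite
subset with an upper bound. -/
def CalibreOmega1Omega (P : Type*) [Preorder P] : Prop :=
  ∀ S : Set P, ¬ S.Countable → ∃ T ⊆ S, T.Infinite ∧ ∃ b : P, ∀ t ∈ T, t ≤ b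

/-- A collection `C` of subsets of `X` is `P`-locally finite. -/
def PLocallyFinite (P : Type*) [Preorder P] {X : Type*} [TopologicalSpace X]
    (C : Set (Set X)) : Prop :=
  ∃ c : P → Set (Set X), (∀ p p' : P, p ≤ p' → c p ⊆ c p') ∧
    (∀ p, LocallyFiniteFamily (c p)) ∧ (⋃ p, c p) = C

def IsOpenCover {X : Type*} [TopologicalSpace X] (U : Set (Set X)) : Prop :=
  (∀ V ∈ U, IsOpen V) ∧ ⋃₀ U = univ

def IsRefinement {X : Type*} (V U : Set (Set X)) : Prop :=
  ∀ W ∈ V, ∃ W' ∈ U, W ⊆ W'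

/-- `X` is `P`-paracompact: every open cover has a `P`-locally finite open refinement. -/
def PParacompact (P : Type*) [Preorder P] (X : Type*) [TopologicalSpace X] : Prop :=
  ∀ U : Set (Set X), IsOpenCover U →
    ∃ V : Set (Set X), IsOpenCover V ∧ IsRefinement V U ∧ PLocallyFinite P V

/-- A collection is (ω₁,ω)-locally finite: every uncountable subcollection contains
an infinite locally finite subcollection. -/
def Omega1OmegaLF {X : Type*} [TopologicalSpace X] (C : Set (Set X)) : Prop :=
  ∀ D ⊆ C, ¬ D.Countable → ∃ E ⊆ D, E.Infinite ∧ LocallyFiniteFamily E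

def Omega1OmegaParacompact (X : Type*) [TopologicalSpace X] : Prop :=
  ∀ U : Set (Set X), IsOpenCover U →
    ∃ V : Set (Set X), IsOpenCover V ∧ IsRefinement V U ∧ Omega1OmegaLF V

/-- `B` is a base for the topology of `X`. -/
def IsBase {X : Type*} [TopologicalSpace X] (B : Set (Set X)) : Prop :=
  (∀ b ∈ B, IsOpen b) ∧ ∀ U : Set X, IsOpen U → ∀ x ∈ U, ∃ b ∈ B, x ∈ b ∧ b ⊆ U

/-- `X` is `P`-metrizable: it has a `(P × ℕ)`-locally finite base. -/
def PMetrizable (P : Type*) [Preorder P] (X : Type*) [TopologicalSpace X] : Prop :=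
  ∃ B : Set (Set X), IsBase B ∧ PLocallyFinite (P × ℕ) B

def Omega1OmegaMetrizable (X : Type*) [TopologicalSpace X] : Prop :=
  ∃ B : Set (Set X), IsBase B ∧ Omega1OmegaLF B

/-- Pseudocompact: every locally finite family of nonempty open sets is finite. -/
def Pseudocompact (X : Type*) [TopologicalSpace X] : Prop :=
  ∀ C : Set (Set X), (∀ U ∈ C, IsOpen U ∧ U.Nonempty) → LocallyFiniteFamily C → C.Finite

/-- The directed set of compact subsets of `M`, ordered by inclusion. -/
abbrev KM (M : Type*) [TopologicalSpace M] : Type _ := {K : Set M // IsCompact K}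

/-- `X` is 𝒦(𝓜)-paracompact: every open cover has a `𝒦(M)`-locally finite open
refinement for some separable metrizable `M`. -/
def KMclassParacompact (X : Type*) [TopologicalSpace X] : Prop :=
  ∀ U : Set (Set X), IsOpenCover U →
    ∃ (M : Type) (_ : TopologicalSpace M), SeparableSpace M ∧ MetrizableSpace M ∧
      ∃ V : Set (Set X), IsOpenCover V ∧ IsRefinement V U ∧ PLocallyFinite (KM M) V

/-- Weakly σ-locally finite collection. -/
def WeaklySigmaLF {X : Type*} [TopologicalSpace X] (C : Set (Set X)) : Prop :=
  ∃ c : ℕ → Set (Set X), (⋃ n, c n) = C ∧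
    ∀ x : X, ∀ A ∈ C, ∃ n, A ∈ c n ∧ LocallyFiniteAt x (c n)

/-- Relatively locally finite: locally finite at every point of its union. -/
def RelLocallyFinite {X : Type*} [TopologicalSpace X] (C : Set (Set X)) : Prop :=
  ∀ x ∈ ⋃₀ C, LocallyFiniteAt x C

def SigmaRelLF {X : Type*} [TopologicalSpace X] (C : Set (Set X)) : Prop :=
  ∃ c : ℕ → Set (Set X), (⋃ n, c n) = C ∧ ∀ n, RelLocallyFinite (c n)

def SigmaRelParacompact (X : Type*) [TopologicalSpace X] : Prop :=
  ∀ U : Set (Set X), IsOpenCover U →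
    ∃ V : Set (Set X), IsOpenCover V ∧ IsRefinement V U ∧ SigmaRelLF V

/-- An open set `U` is `P`-regular. -/
def PRegular (P : Type*) [Preorder P] {X : Type*} [TopologicalSpace X] (U : Set X) : Prop :=
  ∃ V : P × ℕ → Set X, (∀ q, IsOpen (V q)) ∧ (∀ q q' : P × ℕ, q ≤ q' → V q ⊆ V q') ∧
    (⋃ q, V q) = U ∧ (⋃ q, closure (V q)) = U

def PPerfectlyNormal (P : Type*) [Preorder P] (X : Type*) [TopologicalSpace X] : Prop :=
  ∀ U : Set X, IsOpen U → PRegular P U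

/-- A development for `X`. -/
def IsDevelopment {X : Type*} [TopologicalSpace X] (G : ℕ → Set (Set X)) : Prop :=
  (∀ n, IsOpenCover (G n)) ∧
    ∀ (x : X) (U : Set X), IsOpen U → x ∈ U → ∃ n, ⋃₀ {g ∈ G n | x ∈ g} ⊆ U

/-- A Moore space is a regular Hausdorff space with a development; here we record
just the existence of a development (regularity is a separate hypothesis). -/
def HasDevelopment (X : Type*) [TopologicalSpace X] : Prop :=
  ∃ G : ℕ → Set (Set X), IsDevelopment G

/-- Countably paracompact: every countable open cover has a locally finite open refinement. -/
def CountablyParacompact (X : Type*) [TopologicalSpace X] : Prop :=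
  ∀ U : Set (Set X), IsOpenCover U → U.Countable →
    ∃ V : Set (Set X), IsOpenCover V ∧ IsRefinement V U ∧ LocallyFiniteFamily V

/-- ccc: every pairwise disjoint family of nonempty open sets is countable. -/
def CCC (X : Type*) [TopologicalSpace X] : Prop :=
  ∀ C : Set (Set X), (∀ U ∈ C, IsOpen U ∧ U.Nonempty) → C.Pairwise Disjoint → C.Countable

/-- Cofinal subset of a preorder. -/
def CofinalSet {P : Type*} [Preorder P] (C : Set P) : Prop :=
  ∀ p : P, ∃ c ∈ C, p ≤ c

/-- `Q` is a Tukey quotient of `P`. -/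
def TukeyQuotient (P : Type*) [Preorder P] (Q : Type*) [Preorder Q] : Prop :=
  ∃ φ : P → Q, ∀ C : Set P, CofinalSet C → CofinalSet (φ '' C)
/-- An (ω₁,ω)-locally finite family of open sets in a space with a dense σ-compact subset
is countable. -/
lemma countable_of_omega1OmegaLF {X : Type*} [TopologicalSpace X]
    (hdense : ∃ D : Set X, Dense D ∧
      ∃ K : ℕ → Set X, (∀ n, IsCompact (K n)) ∧ (⋃ n, K n) = D)
    {C : Set (Set X)} (hC : ∀ V ∈ C, IsOpen V) (h : Omega1OmegaLF C) : C.Countable := by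
  obtain ⟨D, hD, K, hK, rfl⟩ := hdense
  have key : ∀ n, {A ∈ C | (A ∩ K n).Nonempty}.Countable := by
    intro n
    by_contra hn
    obtain ⟨E, hE, hinf, hlf⟩ := h _ (fun A hA => hA.1) hn
    choose U hU hfin using hlf
    obtain ⟨t, -, ht⟩ := (hK n).elim_nhds_subcover U (fun x _ => hU x)
    refine hinf ((t.finite_toSet.biUnion (fun x _ => hfin x)).subset ?_)
    intro A hA
    obtain ⟨y, hyA, hyK⟩ := (hE hA).2
    obtain ⟨x, hx, hyx⟩ := mem_iUnion₂.1 (ht hyK)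
    exact mem_iUnion₂.2 ⟨x, hx, hA, y, hyA, hyx⟩
  refine ((countable_iUnion key).union (countable_singleton ∅)).mono ?_
  intro A hA
  rcases A.eq_empty_or_nonempty with h0 | h0
  · exact Or.inr h0
  · obtain ⟨y, hyA, hy⟩ := hD.inter_open_nonempty A (hC A hA) h0
    obtain ⟨n, hn⟩ := mem_iUnion.1 hy
    exact Or.inl (mem_iUnion.2 ⟨n, hA, y, hyA, hn⟩)

/-- Let `X` have a dense σ-compact subset. If `X` is (ω₁,ω)-paracompact
then `X` is Lindelöf; and if `X` is regular Hausdorff and (ω₁,ω)-metrizable then `X` is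
separable metrizable. -/
theorem statement18 (X : Type*) [TopologicalSpace X]
    (hdense : ∃ D : Set X, Dense D ∧
      ∃ K : ℕ → Set X, (∀ n, IsCompact (K n)) ∧ (⋃ n, K n) = D) :
    (Omega1OmegaParacompact X → LindelofSpace X) ∧
    (T2Space X → RegularSpace X → Omega1OmegaMetrizable X →
      SeparableSpace X ∧ MetrizableSpace X) := by
  constructor
  · intro hp
    refine ⟨isLindelof_of_countable_subcover ?_⟩
    intro ι U hU hcov
    obtain ⟨V, hV, href, hlf⟩ := hp (range U)
      ⟨by rintro _ ⟨i, rfl⟩; exact hU i, by rw [sUnion_range]; exact univ_subset_iff.1 hcov⟩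
    have hc : V.Countable := countable_of_omega1OmegaLF hdense hV.1 hlf
    have href' : ∀ W : V, ∃ i, (W : Set X) ⊆ U i := by
      rintro ⟨W, hW⟩
      obtain ⟨_, ⟨i, rfl⟩, hi⟩ := href W hW
      exact ⟨i, hi⟩
    choose f hf using href'
    have := hc.to_subtype
    refine ⟨range f, countable_range f, ?_⟩
    intro x _
    have hx : x ∈ ⋃₀ V := hV.2 ▸ mem_univ x
    obtain ⟨W, hW, hxW⟩ := hx
    exact mem_iUnion₂.2 ⟨f ⟨W, hW⟩, mem_range_self _, hf ⟨W, hW⟩ hxW⟩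
  · rintro hT2 hReg ⟨B, hB, hlf⟩
    have hc : B.Countable := countable_of_omega1OmegaLF hdense hB.1 hlf
    have hbase : IsTopologicalBasis B :=
      isTopologicalBasis_of_isOpen_of_nhds hB.1 (fun x U hx hU => hB.2 U hU x hx)
    have : SecondCountableTopology X := hbase.secondCountableTopology hc
    exact ⟨inferInstance, inferInstance⟩
end

section
/- Let B be a totally imperfect subset of ℝ of cardinality 𝔠 (the cardinality of the continuum), and let S be a set with |S| ≤ 𝔠. Then 𝒦(B) ≥_T [S]^{≤ω}, i.e. [S]^{≤ω} is a Tukey quotient of 𝒦(B). -/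
open Set TopologicalSpace Topology

/-- If `B ⊆ ℝ` is totally imperfect of cardinality 𝔠 and `S` is a set
with `|S| ≤ 𝔠`, then `𝒦(B) ≥_T [S]^{≤ω}`. -/
theorem statement19 (B : Set ℝ)
    (hti : ∀ K : Set ℝ, K ⊆ B → IsCompact K → K.Countable)
    (hcard : Cardinal.mk B = Cardinal.continuum)
    (S : Type*) (hS : Cardinal.mk S ≤ Cardinal.continuum) :
    TukeyQuotient (KM B) {C : Set S // C.Countable} := by
  classical
  have hO : Cardinal.mk (Option S) ≤ Cardinal.continuum := by
    rw [Cardinal.mk_option]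
    exact Cardinal.add_le_of_le Cardinal.aleph0_le_continuum hS
      (Cardinal.one_le_aleph0.trans Cardinal.aleph0_le_continuum)
  have hF : Cardinal.mk (ℕ → Option S) ≤ Cardinal.continuum := by
    rw [Cardinal.mk_arrow]
    simp only [Cardinal.lift_id, Cardinal.mk_nat, Cardinal.lift_aleph0, Cardinal.lift_uzero]
    exact (Cardinal.power_le_power_right hO).trans Cardinal.continuum_power_aleph0.le
  let g : (ℕ → Option S) → {C : Set S // C.Countable} := fun u =>
    ⟨{s | some s ∈ range u}, (countable_range u).preimage (Option.some_injective S)⟩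
  have hg : Function.Surjective g := by
    rintro ⟨C, hC⟩
    obtain ⟨u, hu⟩ := ((hC.image some).insert none).exists_eq_range (insert_nonempty _ _)
    refine ⟨u, Subtype.ext ?_⟩
    ext s
    simp only [g, ← hu]
    simp
  have hQ : Cardinal.mk {C : Set S // C.Countable} ≤ Cardinal.continuum :=
    (Cardinal.mk_le_of_surjective hg).trans hF
  obtain ⟨e⟩ : Nonempty ({C : Set S // C.Countable} ↪ B) := by
    rw [← Cardinal.lift_mk_le', hcard, Cardinal.lift_uzero, Cardinal.lift_continuum]
    exact hQ
  have : Nonempty {C : Set S // C.Countable} := ⟨⟨∅, countable_empty⟩⟩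
  have hf : Function.Surjective (Function.invFun e) := Function.invFun_surjective e.injective
  set f : B → {C : Set S // C.Countable} := Function.invFun e
  have hK : ∀ K : KM B, K.1.Countable := by
    intro K
    have h := hti ((↑) '' K.1) (by rintro _ ⟨x, _, rfl⟩; exact x.2)
      (K.2.image continuous_subtype_val)
    exact countable_of_injective_of_countable_image Subtype.val_injective.injOn h
  refine ⟨fun K => ⟨⋃ x ∈ K.1, (f x).1, (hK K).biUnion fun x _ => (f x).2⟩, ?_⟩
  intro C hC q
  obtain ⟨x, rfl⟩ := hf q
  obtain ⟨K, hKC, hxK⟩ := hC ⟨{x}, isCompact_singleton⟩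
  refine ⟨_, ⟨K, hKC, rfl⟩, ?_⟩
  exact subset_biUnion_of_mem (u := fun x => (f x).1) (hxK rfl)
end
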